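/- Let α ∈ [0, π/2), let A, B ∈ M_n(ℂ) be sector matrices of angle α, and let 1 ≤ k ≤ n. Then ∏_{j=1}^{k} s_j(A + B) ≤ ∏_{j=1}^{k} s_j(I_n + sec²(α)·A) · ∏_{j=1}^{k} s_j(I_n + sec²(α)·B). -/

import Mathlib

open Matrix
open scoped ComplexOrder

/-- The real (Hermitian) part of a complex matrix: `Re A = (A + Aᴴ)/2`. -/
noncomputable def matRe {n : ℕ} (A : Matrix (Fin n) (Fin n) ℂ) : Matrix (Fin n) (Fin n) ℂ :=
  (2⁻¹ : ℂ) • (A + Aᴴ)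

/-- `A` is a sector matrix of angle `α`: its numerical range is contained in
`S_α = {z : Re z > 0, |Im z| ≤ tan α · Re z}`. -/
def InSector {n : ℕ} (α : ℝ) (A : Matrix (Fin n) (Fin n) ℂ) : Prop :=
  ∀ x : Fin n → ℂ, star x ⬝ᵥ x = 1 →
    0 < (star x ⬝ᵥ A *ᵥ x).re ∧
      |(star x ⬝ᵥ A *ᵥ x).im| ≤ Real.tan α * (star x ⬝ᵥ A *ᵥ x).re

/-- The `j`-th largest singular value of `X` (eigenvalues of `(XᴴX)^{1/2}` in
decreasing order): `sval X 0 ≥ sval X 1 ≥ …`. -/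
noncomputable def sval {n : ℕ} (X : Matrix (Fin n) (Fin n) ℂ) (j : Fin n) : ℝ :=
  Real.sqrt ((Matrix.posSemidef_conjTranspose_mul_self X).1.eigenvalues
    (Tuple.sort (Matrix.posSemidef_conjTranspose_mul_self X).1.eigenvalues j.rev))

/-! ### Determinant inequalities, stated through norms of complex determinants -/

section Helpers

variable {ι κ : Type*} [Fintype ι] [DecidableEq ι] [Fintype κ] [DecidableEq κ]

open scoped MatrixOrder in
lemma psd_factor {R : Matrix ι ι ℂ} (h : R.PosSemidef) :
    ∃ S : Matrix ι ι ℂ, R = Sᴴ * S := by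

  obtain ⟨S, hS⟩ := CStarAlgebra.nonneg_iff_eq_star_mul_self.mp (Matrix.nonneg_iff_posSemidef.mpr h)
  exact ⟨S, hS⟩

lemma pd_factor {R : Matrix ι ι ℂ} (h : R.PosDef) :
    ∃ S : Matrix ι ι ℂ, IsUnit S.det ∧ R = Sᴴ * S := by
  obtain ⟨S, hS⟩ := psd_factor h.posSemidef
  refine ⟨S, ?_, hS⟩
  have h2 : R.det ≠ 0 := h.det_pos.ne'
  rw [hS, det_mul] at h2
  exact isUnit_iff_ne_zero.mpr (right_ne_zero_of_mul h2)

lemma one_le_det {D : Matrix ι ι ℂ} (h : D.PosSemidef) : 1 ≤ ‖(1 + D).det‖ := by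
  have h1 : (1 + D).det = ∏ i, (1 + (h.1.eigenvalues i : ℂ)) := by
    have hs := h.1.spectral_theorem
    rw [Unitary.conjStarAlgAut_apply] at hs
    set W := (h.1.eigenvectorUnitary : Matrix ι ι ℂ) with hW
    have hWW : W * star W = 1 := by simp [hW]
    have hWW' : star W * W = 1 := by simp [hW]
    have : 1 + D = W * (1 + diagonal (RCLike.ofReal ∘ h.1.eigenvalues)) * star W := by
      rw [mul_add, add_mul, ← hs, mul_one, hWW]
    rw [this, det_mul_right_comm, hWW, one_mul, ← diagonal_one, diagonal_add, det_diagonal]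
    rfl
  rw [h1, norm_prod]
  refine le_trans (by simp) (Finset.prod_le_prod (s := Finset.univ) (f := fun _ => (1 : ℝ))
    (fun i _ => zero_le_one) fun i _ => ?_)
  have h0 := h.eigenvalues_nonneg i
  have : (1 + (h.1.eigenvalues i : ℂ)) = ((1 + h.1.eigenvalues i : ℝ) : ℂ) := by push_cast; rfl
  rw [this, Complex.norm_real, Real.norm_of_nonneg (by linarith)]
  linarith

/-- Monotonicity of the determinant on positive semidefinite matrices. -/
lemma det_mono_psd {A B : Matrix ι ι ℂ} (hA : A.PosSemidef) (h : (B - A).PosSemidef) :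
    ‖A.det‖ ≤ ‖B.det‖ := by
  by_cases h0 : A.det = 0
  · simp [h0]
  obtain ⟨S, hS, rfl⟩ := pd_factor (hA.posDef_iff_det_ne_zero.mpr h0)
  have hS' : IsUnit Sᴴ.det := by rw [det_conjTranspose]; exact hS.star
  have hB : B = Sᴴ * (1 + (S⁻¹)ᴴ * (B - Sᴴ * S) * S⁻¹) * S := by
    have e1 : Sᴴ * (S⁻¹)ᴴ = 1 := by rw [← conjTranspose_mul, nonsing_inv_mul _ hS, conjTranspose_one]
    have e2 : S⁻¹ * S = 1 := nonsing_inv_mul _ hS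
    calc B = Sᴴ * S + (B - Sᴴ * S) := by abel
      _ = Sᴴ * S + (Sᴴ * (S⁻¹)ᴴ) * (B - Sᴴ * S) * (S⁻¹ * S) := by rw [e1, e2]; simp
      _ = _ := by simp only [mul_add, add_mul, mul_one, Matrix.mul_assoc]
  have := one_le_det (h.conjTranspose_mul_mul_same S⁻¹)
  rw [hB, det_mul, det_mul, det_mul, norm_mul, norm_mul, norm_mul]
  have p1 := norm_nonneg (Sᴴ.det)
  have p2 := norm_nonneg (S.det)
  calc ‖Sᴴ.det‖ * ‖S.det‖ = ‖Sᴴ.det‖ * 1 * ‖S.det‖ := by ring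
    _ ≤ _ := by gcongr

/-- Cauchy-Schwarz inequality for determinants. -/
lemma det_cs (M N : Matrix ι κ ℂ) (h : IsUnit (Mᴴ * M).det) :
    ‖(Mᴴ * N).det‖ ^ 2 ≤ ‖(Mᴴ * M).det‖ * ‖(Nᴴ * N).det‖ := by
  set G := Mᴴ * M with hG
  have hGh : Gᴴ = G := by simp [hG]
  have hGi : (G⁻¹)ᴴ = G⁻¹ := by rw [conjTranspose_nonsing_inv, hGh]
  set P := M * G⁻¹ * Mᴴ with hP
  have hPh : Pᴴ = P := by simp [hP, hGi, Matrix.mul_assoc]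
  have hPP : P * P = P := by
    calc P * P = M * (G⁻¹ * G) * G⁻¹ * Mᴴ := by simp only [hP, hG, Matrix.mul_assoc]
      _ = P := by rw [nonsing_inv_mul _ h, Matrix.mul_one]
  have h1 : (1 - P).PosSemidef := by
    have : 1 - P = (1 - P)ᴴ * (1 - P) := by
      rw [conjTranspose_sub, hPh, conjTranspose_one]
      simp [sub_mul, mul_sub, hPP]
    rw [this]; exact posSemidef_conjTranspose_mul_self _
  have h2 := h1.conjTranspose_mul_mul_same N
  have h3 : Nᴴ * (1 - P) * N = Nᴴ * N - (Mᴴ * N)ᴴ * G⁻¹ * (Mᴴ * N) := by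
    simp only [hP, Matrix.mul_sub, Matrix.sub_mul, Matrix.mul_one,
      conjTranspose_mul, conjTranspose_conjTranspose, Matrix.mul_assoc]
  have hGp : G⁻¹.PosSemidef := (posSemidef_conjTranspose_mul_self M).inv
  rw [h3] at h2
  have h4 := det_mono_psd (hGp.conjTranspose_mul_mul_same (Mᴴ * N)) h2
  rw [det_mul, det_mul, det_conjTranspose, norm_mul, norm_mul, norm_star, det_nonsing_inv,
    Ring.inverse_eq_inv', norm_inv] at h4
  have h5 : 0 < ‖G.det‖ := norm_pos_iff.mpr h.ne_zero
  calc ‖(Mᴴ * N).det‖ ^ 2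
      = ‖G.det‖ * (‖(Mᴴ * N).det‖ * ‖G.det‖⁻¹ * ‖(Mᴴ * N).det‖) := by field_simp
    _ ≤ _ := by gcongr

lemma det_smul_one_add_comm (δ : ℂ) (X Y : Matrix ι ι ℂ) :
    (δ • (1 : Matrix ι ι ℂ) + X * Y).det = (δ • (1 : Matrix ι ι ℂ) + Y * X).det := by
  have h := congrArg (Polynomial.eval δ) (charpoly_mul_comm (-X) Y)
  rw [Matrix.eval_charpoly, Matrix.eval_charpoly] at h
  simpa [← smul_one_eq_diagonal, scalar_apply] using h

lemma det_add_le {P Q : Matrix ι ι ℂ} (hP : P.PosSemidef) (hQ : Q.PosSemidef) :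
    ‖(P + Q).det‖ ≤ ‖(1 + P).det‖ * ‖(1 + Q).det‖ := by
  have h1 : ‖(P + Q).det‖ ≤ ‖(1 + P + Q).det‖ := by
    apply det_mono_psd (hP.add hQ)
    have : 1 + P + Q - (P + Q) = 1 := by abel
    rw [this]; exact PosSemidef.one
  have hpd : (1 + P).PosDef := PosDef.one.add_posSemidef hP
  have hu : IsUnit (1 + P).det := isUnit_iff_ne_zero.mpr hpd.det_pos.ne'
  obtain ⟨L, rfl⟩ := psd_factor hQ
  set J := (1 + P)⁻¹ with hJ
  have hJh : Jᴴ = J := hpd.inv.1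
  have e1 : 1 + P + Lᴴ * L = (1 + P) * (1 + J * Lᴴ * L) := by
    rw [mul_add, mul_one, ← Matrix.mul_assoc, ← Matrix.mul_assoc, hJ, mul_nonsing_inv _ hu, one_mul]
  have e2 : (1 + J * Lᴴ * L).det = (1 + L * J * Lᴴ).det := by
    have := det_smul_one_add_comm 1 (J * Lᴴ) L
    simpa [Matrix.mul_assoc] using this
  have e3 : (1 + Lᴴ * L).det = (1 + L * Lᴴ).det := by
    simpa using det_smul_one_add_comm 1 Lᴴ L
  have hJ1 : (1 - J).PosSemidef := by
    have : 1 - J = Jᴴ * P * J + (P * J)ᴴ * (P * J) := by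
      have a : (1 + P) * J = 1 := mul_nonsing_inv _ hu
      have b : J * (1 + P) = 1 := nonsing_inv_mul _ hu
      have c : P * J = 1 - J := by rw [eq_sub_iff_add_eq, ← a]; noncomm_ring
      rw [conjTranspose_mul, hP.1.eq, hJh]
      calc 1 - J = (J * (1 + P)) * (1 - J) := by rw [b, one_mul]
        _ = (J * (1 + P)) * (P * J) := by rw [c]
        _ = _ := by noncomm_ring
    rw [this]
    exact (hP.conjTranspose_mul_mul_same J).add (posSemidef_conjTranspose_mul_self _)
  have h2 : ‖(1 + L * J * Lᴴ).det‖ ≤ ‖(1 + L * Lᴴ).det‖ := by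
    apply det_mono_psd
    · exact PosSemidef.one.add (hpd.inv.posSemidef.mul_mul_conjTranspose_same L)
    · have : 1 + L * Lᴴ - (1 + L * J * Lᴴ) = L * (1 - J) * Lᴴ := by noncomm_ring
      rw [this]; exact hJ1.mul_mul_conjTranspose_same L
  calc _ ≤ _ := h1
    _ = ‖(1 + P).det‖ * ‖(1 + L * J * Lᴴ).det‖ := by rw [e1, det_mul, e2, norm_mul]
    _ ≤ _ := by rw [e3]; gcongr

/-- A Hermitian-plus-skew pair can be simultaneously normalised. -/
lemma normalise {H K : Matrix ι ι ℂ} (hH : H.PosDef) (hK : K.IsHermitian) :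
    ∃ S L : Matrix ι ι ℂ, H = Sᴴ * S ∧ K = Sᴴ * L * S ∧ L.IsHermitian ∧ IsUnit S.det ∧
      L = (S⁻¹)ᴴ * K * S⁻¹ ∧ (S⁻¹)ᴴ * H * S⁻¹ = 1 := by
  obtain ⟨S, hS, rfl⟩ := pd_factor hH
  have e1 : Sᴴ * (S⁻¹)ᴴ = 1 := by rw [← conjTranspose_mul, nonsing_inv_mul _ hS, conjTranspose_one]
  have e3 : (S⁻¹)ᴴ * Sᴴ = 1 := by rw [← conjTranspose_mul, mul_nonsing_inv _ hS, conjTranspose_one]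
  have e2 : S⁻¹ * S = 1 := nonsing_inv_mul _ hS
  have e4 : S * S⁻¹ = 1 := mul_nonsing_inv _ hS
  refine ⟨S, (S⁻¹)ᴴ * K * S⁻¹, rfl, ?_, isHermitian_conjTranspose_mul_mul _ hK, hS, rfl, ?_⟩
  · calc K = (Sᴴ * (S⁻¹)ᴴ) * K * (S⁻¹ * S) := by rw [e1, e2]; simp
      _ = _ := by simp only [Matrix.mul_assoc]
  · calc _ = ((S⁻¹)ᴴ * Sᴴ) * (S * S⁻¹) := by simp only [Matrix.mul_assoc]
      _ = 1 := by rw [e3, e4, mul_one]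

lemma skew_norm {L : Matrix ι ι ℂ} (hL : L.IsHermitian) :
    (1 + Complex.I • L)ᴴ * (1 + Complex.I • L) = 1 + L * L := by
  rw [conjTranspose_add, conjTranspose_smul, hL.eq, conjTranspose_one]
  have hI : star Complex.I = -Complex.I := Complex.conj_I
  have e : (Complex.I • L) * (Complex.I • L) = -(L * L) := by
    rw [smul_mul_smul_comm, Complex.I_mul_I, neg_one_smul]
  rw [hI, neg_smul]
  generalize Complex.I • L = Y at *
  calc (1 + -Y) * (1 + Y) = 1 - Y * Y := by noncomm_ring
    _ = _ := by rw [e]; abel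

/-- Ostrowski-Taussky inequality. -/
lemma det_re_le {H K : Matrix ι ι ℂ} (hH : H.PosDef) (hK : K.IsHermitian) :
    ‖H.det‖ ≤ ‖(H + Complex.I • K).det‖ := by
  obtain ⟨S, L, h1, h2, hL, hS, -, -⟩ := normalise hH hK
  have e : H + Complex.I • K = Sᴴ * (1 + Complex.I • L) * S := by
    rw [h1, h2, mul_add, add_mul, mul_one, mul_smul_comm, smul_mul_assoc]
  have h3 : 1 ≤ ‖(1 + Complex.I • L).det‖ := by
    have a : (L * L).PosSemidef := by
      have := posSemidef_conjTranspose_mul_self L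
      rwa [hL.eq] at this
    have b := one_le_det a
    rw [← skew_norm hL, det_mul, det_conjTranspose, norm_mul, norm_star] at b
    by_contra hc
    push Not at hc
    nlinarith [norm_nonneg (1 + Complex.I • L).det]
  rw [e, h1, det_mul, det_mul, det_mul, norm_mul, norm_mul, norm_mul]
  calc ‖Sᴴ.det‖ * ‖S.det‖ = ‖Sᴴ.det‖ * 1 * ‖S.det‖ := by ring
    _ ≤ _ := by gcongr

open scoped MatrixOrder in
lemma sq_le_of_bound {L : Matrix ι ι ℂ} {t : ℝ} (hp : ((t : ℂ) • 1 + L).PosSemidef)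
    (hm : ((t : ℂ) • 1 - L).PosSemidef) : (((t ^ 2 : ℝ) : ℂ) • 1 - L * L).PosSemidef := by

  have hc : Commute ((t : ℂ) • 1 + L) ((t : ℂ) • 1 - L) := by
    have h1 : Commute ((t : ℂ) • (1 : Matrix ι ι ℂ)) L := (Commute.one_left L).smul_left _
    exact ((Commute.refl _).sub_right h1).add_left (h1.symm.sub_right (Commute.refl _))
  have := hc.mul_nonneg (Matrix.nonneg_iff_posSemidef.mpr hp) (Matrix.nonneg_iff_posSemidef.mpr hm)
  rw [Matrix.nonneg_iff_posSemidef] at this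
  have e : ((t : ℂ) • 1 + L) * ((t : ℂ) • 1 - L) = ((t ^ 2 : ℝ) : ℂ) • 1 - L * L := by
    rw [add_mul, mul_sub, mul_sub, smul_one_mul, smul_one_mul, mul_smul_comm, mul_one, smul_smul]
    push_cast
    rw [pow_two]
    abel
  rw [← e]
  exact this

/-- Generalised sectorial Cauchy-Schwarz inequality for determinants. -/
lemma det_sector {H K : Matrix ι ι ℂ} {t : ℝ} (hH : H.PosDef) (hK : K.IsHermitian)
    (hp : ((t : ℂ) • H + K).PosSemidef) (hm : ((t : ℂ) • H - K).PosSemidef)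
    (U V : Matrix ι κ ℂ) (hU : (Uᴴ * H * U).PosDef) :
    ‖(Uᴴ * (H + Complex.I • K) * V).det‖ ^ 2 ≤
      (1 + t ^ 2) ^ Fintype.card κ * ‖(Uᴴ * H * U).det‖ * ‖(Vᴴ * H * V).det‖ := by
  obtain ⟨S, L, h1, h2, hL, hS, h3, h4⟩ := normalise hH hK
  have bp : ((t : ℂ) • 1 + L).PosSemidef := by
    have := hp.conjTranspose_mul_mul_same S⁻¹
    rwa [mul_add, add_mul, ← h3, mul_smul_comm, smul_mul_assoc, h4] at this
  have bm : ((t : ℂ) • 1 - L).PosSemidef := by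
    have := hm.conjTranspose_mul_mul_same S⁻¹
    rwa [mul_sub, sub_mul, ← h3, mul_smul_comm, smul_mul_assoc, h4] at this
  have hsq := sq_le_of_bound bp bm
  set Z := 1 + Complex.I • L with hZ
  have e : H + Complex.I • K = Sᴴ * Z * S := by
    rw [h1, h2, hZ, mul_add, add_mul, mul_one, mul_smul_comm, smul_mul_assoc]
  have eM : (S * U)ᴴ * (S * U) = Uᴴ * H * U := by
    rw [h1, conjTranspose_mul]; simp only [Matrix.mul_assoc]
  have hu : IsUnit ((S * U)ᴴ * (S * U)).det := by
    rw [eM]; exact isUnit_iff_ne_zero.mpr hU.det_pos.ne'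
  have cs := det_cs (S * U) (Z * S * V) hu
  have eN : (S * U)ᴴ * (Z * S * V) = Uᴴ * (H + Complex.I • K) * V := by
    rw [e, conjTranspose_mul]; simp only [Matrix.mul_assoc]
  rw [eM, eN] at cs
  have eZ : (Z * S * V)ᴴ * (Z * S * V) = (S * V)ᴴ * (1 + L * L) * (S * V) := by
    rw [← skew_norm hL, ← hZ]; simp only [conjTranspose_mul, Matrix.mul_assoc]
  have hb : ‖((Z * S * V)ᴴ * (Z * S * V)).det‖ ≤
      (1 + t ^ 2) ^ Fintype.card κ * ‖(Vᴴ * H * V).det‖ := by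
    have := det_mono_psd (A := (Z * S * V)ᴴ * (Z * S * V))
      (B := ((1 + t ^ 2 : ℝ) : ℂ) • (Vᴴ * H * V)) (posSemidef_conjTranspose_mul_self _) (by
        have := hsq.conjTranspose_mul_mul_same (S * V)
        convert this using 1
        rw [eZ, h1]
        simp only [Matrix.mul_add, Matrix.mul_sub, Matrix.add_mul, Matrix.sub_mul, Matrix.mul_one,
          Matrix.mul_smul, Matrix.smul_mul, conjTranspose_mul, Matrix.mul_assoc]
        push_cast
        rw [add_smul, one_smul]
        abel)
    rw [det_smul, norm_mul, norm_pow, Complex.norm_real, Real.norm_of_nonneg (by positivity)] at this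
    exact this
  calc _ ≤ _ := cs
    _ ≤ ‖(Uᴴ * H * U).det‖ * ((1 + t ^ 2) ^ Fintype.card κ * ‖(Vᴴ * H * V).det‖) := by gcongr
    _ = _ := by ring

end Helpers

/-! ### Singular values -/

section Singular

variable {n : ℕ}

lemma sval_nonneg (Y : Matrix (Fin n) (Fin n) ℂ) (j : Fin n) : 0 ≤ sval Y j := Real.sqrt_nonneg _

lemma sval_antitone (Y : Matrix (Fin n) (Fin n) ℂ) : Antitone (sval Y) := by
  intro i j hij
  unfold sval
  apply Real.sqrt_le_sqrt
  exact Tuple.monotone_sort (posSemidef_conjTranspose_mul_self Y).1.eigenvalues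
    (Fin.rev_le_rev.mpr hij)

lemma sval_spectral (Y : Matrix (Fin n) (Fin n) ℂ) :
    ∃ W : Matrix (Fin n) (Fin n) ℂ, Wᴴ * W = 1 ∧ W * Wᴴ = 1 ∧
      Yᴴ * Y = W * diagonal (fun j => ((sval Y j ^ 2 : ℝ) : ℂ)) * Wᴴ := by
  have hH := posSemidef_conjTranspose_mul_self Y
  set τ : Fin n ≃ Fin n := Fin.revPerm.trans (Tuple.sort hH.1.eigenvalues) with hτ
  set W0 := (hH.1.eigenvectorUnitary : Matrix (Fin n) (Fin n) ℂ) with hW0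
  have hs := hH.1.spectral_theorem
  rw [Unitary.conjStarAlgAut_apply] at hs
  have h1 : W0ᴴ * W0 = 1 := Unitary.coe_star_mul_self hH.1.eigenvectorUnitary
  have h2 : W0 * W0ᴴ = 1 := Unitary.coe_mul_star_self hH.1.eigenvectorUnitary
  refine ⟨W0.submatrix id τ, ?_, ?_, ?_⟩
  · have : (W0.submatrix id τ)ᴴ * W0.submatrix id τ = (W0ᴴ * W0).submatrix τ τ := rfl
    rw [this, h1]; simp
  · rw [conjTranspose_submatrix, submatrix_mul_equiv, h2]; simp
  · have : diagonal (fun j => ((sval Y j ^ 2 : ℝ) : ℂ)) =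
        (diagonal (RCLike.ofReal ∘ hH.1.eigenvalues : Fin n → ℂ)).submatrix τ τ := by
      rw [submatrix_diagonal_equiv]
      congr 1
      funext j
      simp only [sval, Function.comp]
      rw [Real.sq_sqrt (hH.eigenvalues_nonneg _)]
      rfl
    rw [this, conjTranspose_submatrix, submatrix_mul_equiv, submatrix_mul_equiv]
    exact hs

lemma prod_filter_lt {k : ℕ} (hkn : k ≤ n) (f : Fin n → ℝ) :
    ∏ j ∈ Finset.univ.filter (fun j : Fin n => (j : ℕ) < k), f j =
      ∏ i : Fin k, f (Fin.castLE hkn i) := by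
  symm
  apply Finset.prod_bij (fun i _ => Fin.castLE hkn i)
  · intro i _; simp
  · intro i _ j _ h; simpa using h
  · intro j hj
    simp only [Finset.mem_filter, Finset.mem_univ, true_and] at hj
    exact ⟨⟨j, hj⟩, Finset.mem_univ _, rfl⟩
  · intro i _; rfl

lemma one_sub_proj_psd {k : ℕ} {X : Matrix (Fin n) (Fin k) ℂ} (hX : Xᴴ * X = 1) :
    (1 - X * Xᴴ).PosSemidef := by
  have : 1 - X * Xᴴ = (1 - X * Xᴴ)ᴴ * (1 - X * Xᴴ) := by
    have hPP : (X * Xᴴ) * (X * Xᴴ) = X * Xᴴ := by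
      calc (X * Xᴴ) * (X * Xᴴ) = X * (Xᴴ * X) * Xᴴ := by simp only [Matrix.mul_assoc]
        _ = _ := by rw [hX, Matrix.mul_one]
    rw [conjTranspose_sub, conjTranspose_one, conjTranspose_mul, conjTranspose_conjTranspose]
    simp [sub_mul, mul_sub, hPP]
  rw [this]; exact posSemidef_conjTranspose_mul_self _

/-- Compression of a sorted diagonal matrix. -/
lemma det_compress_diag {k : ℕ} (hk1 : 1 ≤ k) (hkn : k ≤ n) {d : Fin n → ℝ} (hd : Antitone d)
    (h0 : ∀ i, 0 ≤ d i) {X : Matrix (Fin n) (Fin k) ℂ} (hX : Xᴴ * X = 1) :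
    ‖(Xᴴ * diagonal (fun j => (d j : ℂ)) * X).det‖ ≤ ∏ i : Fin k, d (Fin.castLE hkn i) := by
  set δ : ℝ := d ⟨k - 1, by omega⟩ with hδ
  have hδ0 : 0 ≤ δ := h0 _
  have hδle : ∀ i : Fin k, δ ≤ d (Fin.castLE hkn i) := fun i => hd (by
    rw [Fin.le_def]; simp; omega)
  set F : Matrix (Fin k) (Fin k) ℂ :=
    diagonal (fun i => ((Real.sqrt (d (Fin.castLE hkn i) - δ) : ℝ) : ℂ)) with hF
  have hFh : Fᴴ = F := by
    rw [hF, diagonal_conjTranspose]; congr 1; funext i; simp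
  have hFF : F * F = diagonal (fun i => ((d (Fin.castLE hkn i) - δ : ℝ) : ℂ)) := by
    rw [hF, diagonal_mul_diagonal]; congr 1; funext i
    rw [← Complex.ofReal_mul, Real.mul_self_sqrt (sub_nonneg.mpr (hδle i))]
  set Xk : Matrix (Fin k) (Fin k) ℂ := X.submatrix (Fin.castLE hkn) id with hXk
  set e : Fin n → ℝ := fun j => if (j : ℕ) < k then d j - δ else 0 with he
  have hE : Xᴴ * diagonal (fun j => (e j : ℂ)) * X = (F * Xk)ᴴ * (F * Xk) := by
    have : (F * Xk)ᴴ * (F * Xk) = Xkᴴ * (F * F) * Xk := by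
      rw [conjTranspose_mul, hFh]; simp only [Matrix.mul_assoc]
    rw [this, hFF]
    ext a b
    rw [Matrix.mul_apply, Matrix.mul_apply]
    simp only [mul_diagonal, conjTranspose_apply, hXk, submatrix_apply, id]
    have hs : ∀ j : Fin n, star (X j a) * (e j : ℂ) * X j b =
        if (j : ℕ) < k then star (X j a) * ((d j - δ : ℝ) : ℂ) * X j b else 0 := by
      intro j
      simp only [he]
      split_ifs <;> simp
    simp_rw [hs]
    rw [← Finset.sum_filter]
    symm
    apply Finset.sum_bij (fun i _ => Fin.castLE hkn i)
    · intro i _; simp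
    · intro i _ j _ h; simpa using h
    · intro j hj
      simp only [Finset.mem_filter, Finset.mem_univ, true_and] at hj
      exact ⟨⟨j, hj⟩, Finset.mem_univ _, rfl⟩
    · intro i _; rfl
  have hDpsd : (diagonal (fun j => (d j : ℂ)) : Matrix (Fin n) (Fin n) ℂ).PosSemidef := by
    apply PosSemidef.diagonal; intro j; simpa using h0 j
  have s1 : ‖(Xᴴ * diagonal (fun j => (d j : ℂ)) * X).det‖ ≤
      ‖((δ : ℂ) • (1 : Matrix (Fin k) (Fin k) ℂ) + (F * Xk)ᴴ * (F * Xk)).det‖ := by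
    apply det_mono_psd (hDpsd.conjTranspose_mul_mul_same X)
    have : (δ : ℂ) • (1 : Matrix (Fin k) (Fin k) ℂ) + (F * Xk)ᴴ * (F * Xk) -
        Xᴴ * diagonal (fun j => (d j : ℂ)) * X =
        Xᴴ * diagonal (fun j => ((δ + e j - d j : ℝ) : ℂ)) * X := by
      have hd3 : (diagonal (fun j => ((δ + e j - d j : ℝ) : ℂ)) : Matrix (Fin n) (Fin n) ℂ) =
          (δ : ℂ) • 1 + diagonal (fun j => (e j : ℂ)) - diagonal (fun j => (d j : ℂ)) := by
        rw [smul_one_eq_diagonal, diagonal_add, diagonal_sub]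
        congr 1; funext j; push_cast; rfl
      rw [← hE, hd3, ← hX]
      simp only [Matrix.mul_add, Matrix.mul_sub, Matrix.add_mul, Matrix.sub_mul, Matrix.mul_one,
          Matrix.mul_smul, Matrix.smul_mul]
    rw [this]
    apply PosSemidef.conjTranspose_mul_mul_same
    apply PosSemidef.diagonal
    intro j
    have : 0 ≤ δ + e j - d j := by
      simp only [he]
      split_ifs with h
      · linarith
      · have : d j ≤ δ := hd (by rw [Fin.le_def]; simp; omega)
        linarith
    simpa only [Pi.zero_apply, Complex.zero_le_real] using this
  have s2 : ((δ : ℂ) • (1 : Matrix (Fin k) (Fin k) ℂ) + (F * Xk)ᴴ * (F * Xk)).det =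
      ((δ : ℂ) • (1 : Matrix (Fin k) (Fin k) ℂ) + (F * Xk) * (F * Xk)ᴴ).det :=
    det_smul_one_add_comm _ _ _
  have hδpsd : ((δ : ℂ) • (1 : Matrix (Fin k) (Fin k) ℂ)).PosSemidef :=
    PosSemidef.one.smul (by simpa using hδ0)
  have s3 : ‖((δ : ℂ) • (1 : Matrix (Fin k) (Fin k) ℂ) + (F * Xk) * (F * Xk)ᴴ).det‖ ≤
      ‖((δ : ℂ) • (1 : Matrix (Fin k) (Fin k) ℂ) + F * F).det‖ := by
    apply det_mono_psd (hδpsd.add (posSemidef_self_mul_conjTranspose _))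
    have h1 : (1 - Xk * Xkᴴ).PosSemidef := by
      have := (one_sub_proj_psd hX).submatrix (Fin.castLE hkn)
      convert this using 1
      have e : (1 - X * Xᴴ).submatrix (Fin.castLE hkn) (Fin.castLE hkn) =
          (1 : Matrix (Fin n) (Fin n) ℂ).submatrix (Fin.castLE hkn) (Fin.castLE hkn) -
            Xk * Xkᴴ := rfl
      rw [e, submatrix_one _ (Fin.castLE_injective hkn)]
    have : (δ : ℂ) • (1 : Matrix (Fin k) (Fin k) ℂ) + F * F -
        ((δ : ℂ) • (1 : Matrix (Fin k) (Fin k) ℂ) + (F * Xk) * (F * Xk)ᴴ) =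
        Fᴴ * (1 - Xk * Xkᴴ) * F := by
      rw [conjTranspose_mul, hFh]
      noncomm_ring
    rw [this]
    exact h1.conjTranspose_mul_mul_same F
  have s4 : ‖((δ : ℂ) • (1 : Matrix (Fin k) (Fin k) ℂ) + F * F).det‖ =
      ∏ i : Fin k, d (Fin.castLE hkn i) := by
    rw [hFF, smul_one_eq_diagonal, diagonal_add, det_diagonal, norm_prod]
    refine Finset.prod_congr rfl fun i _ => ?_
    rw [← Complex.ofReal_add, Complex.norm_real, add_sub_cancel, Real.norm_of_nonneg (h0 _)]
  rw [← s4]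
  exact s1.trans (s2 ▸ s3)

/-- Compressions have determinant bounded by the product of the top singular values. -/
lemma det_compress_le {k : ℕ} (hk1 : 1 ≤ k) (hkn : k ≤ n) (Y : Matrix (Fin n) (Fin n) ℂ)
    {U : Matrix (Fin n) (Fin k) ℂ} (hU : Uᴴ * U = 1) :
    ‖(Uᴴ * Y * U).det‖ ≤ ∏ i : Fin k, sval Y (Fin.castLE hkn i) := by
  obtain ⟨W, hW1, hW2, hW⟩ := sval_spectral Y
  have cs := det_cs U (Y * U) (by rw [hU]; simp)
  have e1 : (Y * U)ᴴ * (Y * U) =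
      (Wᴴ * U)ᴴ * diagonal (fun j => ((sval Y j ^ 2 : ℝ) : ℂ)) * (Wᴴ * U) := by
    calc (Y * U)ᴴ * (Y * U) = Uᴴ * (Yᴴ * Y) * U := by
          rw [conjTranspose_mul]; simp only [Matrix.mul_assoc]
      _ = _ := by
          rw [hW, conjTranspose_mul, conjTranspose_conjTranspose]; simp only [Matrix.mul_assoc]
  have hX : (Wᴴ * U)ᴴ * (Wᴴ * U) = 1 := by
    calc (Wᴴ * U)ᴴ * (Wᴴ * U) = Uᴴ * (W * Wᴴ) * U := by
          rw [conjTranspose_mul, conjTranspose_conjTranspose]; simp only [Matrix.mul_assoc]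
      _ = _ := by rw [hW2, Matrix.mul_one, hU]
  have b := det_compress_diag hk1 hkn (d := fun j => sval Y j ^ 2)
    (fun i j hij => pow_le_pow_left₀ (sval_nonneg _ _) (sval_antitone Y hij) 2)
    (fun i => sq_nonneg _) hX
  rw [hU, det_one, norm_one, one_mul, e1, ← Matrix.mul_assoc] at cs
  have := cs.trans b
  rw [Finset.prod_pow] at this
  exact le_of_sq_le_sq this (Finset.prod_nonneg fun i _ => sval_nonneg _ _)

lemma exists_frames {k : ℕ} (hkn : k ≤ n) (T : Matrix (Fin n) (Fin n) ℂ)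
    (hpos : ∏ i : Fin k, sval T (Fin.castLE hkn i) ≠ 0) :
    ∃ U V : Matrix (Fin n) (Fin k) ℂ, Uᴴ * U = 1 ∧ Vᴴ * V = 1 ∧
      ‖(Uᴴ * T * V).det‖ = ∏ i : Fin k, sval T (Fin.castLE hkn i) := by
  obtain ⟨W, hW1, hW2, hW⟩ := sval_spectral T
  set s : Fin k → ℝ := fun i => sval T (Fin.castLE hkn i) with hs
  have hs0 : ∀ i, s i ≠ 0 := fun i => Finset.prod_ne_zero_iff.mp hpos i (Finset.mem_univ _)
  set V : Matrix (Fin n) (Fin k) ℂ := W.submatrix id (Fin.castLE hkn) with hV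
  have hVV : Vᴴ * V = 1 := by
    have : Vᴴ * V = (Wᴴ * W).submatrix (Fin.castLE hkn) (Fin.castLE hkn) := rfl
    rw [this, hW1, submatrix_one _ (Fin.castLE_injective hkn)]
  have hD : Vᴴ * (Tᴴ * T) * V = diagonal (fun i => ((s i ^ 2 : ℝ) : ℂ)) := by
    have h1 : Wᴴ * (Tᴴ * T) * W = diagonal (fun j => ((sval T j ^ 2 : ℝ) : ℂ)) := by
      rw [hW]
      calc _ = (Wᴴ * W) * diagonal (fun j => ((sval T j ^ 2 : ℝ) : ℂ)) * (Wᴴ * W) := by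
            simp only [Matrix.mul_assoc]
        _ = _ := by rw [hW1, one_mul, mul_one]
    have : Vᴴ * (Tᴴ * T) * V =
        (Wᴴ * (Tᴴ * T) * W).submatrix (Fin.castLE hkn) (Fin.castLE hkn) := rfl
    rw [this, h1, submatrix_diagonal _ _ (Fin.castLE_injective hkn)]
    rfl
  set E : Matrix (Fin k) (Fin k) ℂ := diagonal (fun i => (((s i)⁻¹ : ℝ) : ℂ)) with hE
  have hEh : Eᴴ = E := by rw [hE, diagonal_conjTranspose]; congr 1; funext i; simp
  refine ⟨T * V * E, V, ?_, hVV, ?_⟩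
  · have : (T * V * E)ᴴ * (T * V * E) = E * (Vᴴ * (Tᴴ * T) * V) * E := by
      rw [conjTranspose_mul, conjTranspose_mul, hEh]; simp only [Matrix.mul_assoc]
    rw [this, hD, hE, diagonal_mul_diagonal, diagonal_mul_diagonal, ← diagonal_one]
    congr 1; funext i
    have := hs0 i
    rw [← Complex.ofReal_mul, ← Complex.ofReal_mul]
    rw [show (s i)⁻¹ * s i ^ 2 * (s i)⁻¹ = 1 by field_simp]; simp
  · have : (T * V * E)ᴴ * T * V = E * (Vᴴ * (Tᴴ * T) * V) := by
      rw [conjTranspose_mul, conjTranspose_mul, hEh]; simp only [Matrix.mul_assoc]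
    rw [this, hD, hE, diagonal_mul_diagonal, det_diagonal, norm_prod]
    refine Finset.prod_congr rfl fun i _ => ?_
    have h0 := hs0 i
    rw [← Complex.ofReal_mul, Complex.norm_real, show (s i)⁻¹ * s i ^ 2 = s i by field_simp,
      Real.norm_of_nonneg (sval_nonneg _ _)]

end Singular

/-! ### Sector matrices -/

section Sector

variable {n : ℕ}

/-- The imaginary (Hermitian) part of a complex matrix. -/
noncomputable def matIm (A : Matrix (Fin n) (Fin n) ℂ) : Matrix (Fin n) (Fin n) ℂ :=
  (-(Complex.I / 2)) • (A - Aᴴ)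

lemma matRe_herm (A : Matrix (Fin n) (Fin n) ℂ) : (matRe A).IsHermitian := by
  unfold matRe IsHermitian
  rw [conjTranspose_smul, conjTranspose_add, conjTranspose_conjTranspose, add_comm]
  simp

lemma matIm_herm (A : Matrix (Fin n) (Fin n) ℂ) : (matIm A).IsHermitian := by
  unfold matIm IsHermitian
  rw [conjTranspose_smul, conjTranspose_sub, conjTranspose_conjTranspose, ← neg_sub A, smul_neg,
    ← neg_smul]
  congr 1
  simp [neg_div]

lemma re_add_im (A : Matrix (Fin n) (Fin n) ℂ) : matRe A + Complex.I • matIm A = A := by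
  unfold matRe matIm
  rw [smul_smul]
  have : Complex.I * -(Complex.I / 2) = 2⁻¹ := by
    linear_combination (-(1 / 2) : ℂ) * Complex.I_mul_I
  rw [this, ← smul_add, add_add_sub_cancel, ← two_smul ℂ A, smul_smul]
  simp

lemma matRe_add (A B : Matrix (Fin n) (Fin n) ℂ) : matRe (A + B) = matRe A + matRe B := by
  unfold matRe
  rw [conjTranspose_add, ← smul_add]; congr 1; abel

lemma matIm_add (A B : Matrix (Fin n) (Fin n) ℂ) : matIm (A + B) = matIm A + matIm B := by
  unfold matIm
  rw [conjTranspose_add, ← smul_add]; congr 1; abel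

lemma quad_conj (A : Matrix (Fin n) (Fin n) ℂ) (x : Fin n → ℂ) :
    star x ⬝ᵥ Aᴴ *ᵥ x = star (star x ⬝ᵥ A *ᵥ x) := by
  rw [star_dotProduct, star_mulVec, conjTranspose_conjTranspose, dotProduct_mulVec]

lemma quad_re (A : Matrix (Fin n) (Fin n) ℂ) (x : Fin n → ℂ) :
    star x ⬝ᵥ matRe A *ᵥ x = ((star x ⬝ᵥ A *ᵥ x).re : ℂ) := by
  unfold matRe
  rw [smul_mulVec, add_mulVec, dotProduct_smul, dotProduct_add, quad_conj]
  apply Complex.ext <;> simp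
  ring

lemma quad_im (A : Matrix (Fin n) (Fin n) ℂ) (x : Fin n → ℂ) :
    star x ⬝ᵥ matIm A *ᵥ x = ((star x ⬝ᵥ A *ᵥ x).im : ℂ) := by
  unfold matIm
  rw [smul_mulVec, sub_mulVec, dotProduct_smul, dotProduct_sub, quad_conj]
  apply Complex.ext <;> simp
  ring

lemma sector_all {α : ℝ} {A : Matrix (Fin n) (Fin n) ℂ} (hA : InSector α A) {x : Fin n → ℂ}
    (hx : x ≠ 0) : 0 < (star x ⬝ᵥ A *ᵥ x).re ∧
      |(star x ⬝ᵥ A *ᵥ x).im| ≤ Real.tan α * (star x ⬝ᵥ A *ᵥ x).re := by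
  have hpos : 0 < star x ⬝ᵥ x := dotProduct_star_self_pos_iff.mpr hx
  obtain ⟨hre, him⟩ := Complex.pos_iff.mp hpos
  set N := (star x ⬝ᵥ x).re with hN
  have hNe : star x ⬝ᵥ x = (N : ℂ) := Complex.ext rfl (by simpa using him.symm)
  set r : ℝ := (Real.sqrt N)⁻¹ with hr
  have hr0 : 0 < r := inv_pos.mpr (Real.sqrt_pos.mpr hre)
  have hrr : r * r * N = 1 := by
    have : Real.sqrt N * Real.sqrt N = N := Real.mul_self_sqrt hre.le
    have h1 : Real.sqrt N ≠ 0 := (Real.sqrt_pos.mpr hre).ne'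
    rw [hr]; nth_rewrite 3 [← this]; field_simp
  have hq : ∀ M : Matrix (Fin n) (Fin n) ℂ, star ((r : ℂ) • x) ⬝ᵥ M *ᵥ ((r : ℂ) • x) =
      ((r * r : ℝ) : ℂ) * (star x ⬝ᵥ M *ᵥ x) := by
    intro M
    rw [star_smul, mulVec_smul, smul_dotProduct, dotProduct_smul, smul_eq_mul, smul_eq_mul]
    simp [mul_assoc]
  have h := hA ((r : ℂ) • x) (by
    have := hq 1
    rw [one_mulVec, one_mulVec] at this
    rw [this, hNe, ← Complex.ofReal_mul, hrr, Complex.ofReal_one])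
  rw [hq, Complex.re_ofReal_mul, Complex.im_ofReal_mul, abs_mul, abs_of_pos (mul_pos hr0 hr0)] at h
  refine ⟨(mul_pos_iff_of_pos_left (mul_pos hr0 hr0)).mp h.1, ?_⟩
  refine le_of_mul_le_mul_left ?_ (mul_pos hr0 hr0)
  linarith [h.2]

lemma sector_re {α : ℝ} {A : Matrix (Fin n) (Fin n) ℂ} (hA : InSector α A) :
    (matRe A).PosDef := by
  refine PosDef.of_dotProduct_mulVec_pos (matRe_herm A) fun x hx => ?_
  rw [quad_re]
  exact_mod_cast (sector_all hA hx).1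

lemma sector_bounds {α : ℝ} {A : Matrix (Fin n) (Fin n) ℂ} (hA : InSector α A) :
    ((Real.tan α : ℂ) • matRe A + matIm A).PosSemidef ∧
    ((Real.tan α : ℂ) • matRe A - matIm A).PosSemidef := by
  have hh : ((Real.tan α : ℂ) • matRe A).IsHermitian := by
    unfold IsHermitian
    rw [conjTranspose_smul, (matRe_herm A).eq, Complex.star_def, Complex.conj_ofReal]
  constructor
  · refine PosSemidef.of_dotProduct_mulVec_nonneg (hh.add (matIm_herm A)) fun x => ?_
    rcases eq_or_ne x 0 with rfl | hx
    · simp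
    rw [add_mulVec, dotProduct_add, smul_mulVec, dotProduct_smul, quad_re, quad_im, smul_eq_mul]
    have := abs_le.mp (sector_all hA hx).2
    have h2 : 0 ≤ Real.tan α * (star x ⬝ᵥ A *ᵥ x).re + (star x ⬝ᵥ A *ᵥ x).im := by linarith
    exact_mod_cast h2
  · refine PosSemidef.of_dotProduct_mulVec_nonneg (hh.sub (matIm_herm A)) fun x => ?_
    rcases eq_or_ne x 0 with rfl | hx
    · simp
    rw [sub_mulVec, dotProduct_sub, smul_mulVec, dotProduct_smul, quad_re, quad_im, smul_eq_mul]
    have := abs_le.mp (sector_all hA hx).2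
    have h2 : 0 ≤ Real.tan α * (star x ⬝ᵥ A *ᵥ x).re - (star x ⬝ᵥ A *ᵥ x).im := by linarith
    exact_mod_cast h2

lemma pd_compress {k : ℕ} {H : Matrix (Fin n) (Fin n) ℂ} (hH : H.PosDef)
    {U : Matrix (Fin n) (Fin k) ℂ} (hU : Uᴴ * U = 1) : (Uᴴ * H * U).PosDef := by
  apply hH.conjTranspose_mul_mul_same
  intro x y hxy
  have := congrArg (fun v => Uᴴ *ᵥ v) hxy
  simpa [hU] using this

lemma herm_compress {k : ℕ} {H : Matrix (Fin n) (Fin n) ℂ} (hH : H.IsHermitian)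
    (U : Matrix (Fin n) (Fin k) ℂ) : (Uᴴ * H * U).IsHermitian :=
  isHermitian_conjTranspose_mul_mul _ hH

lemma det_one_add_re_le {k : ℕ} (hk1 : 1 ≤ k) (hkn : k ≤ n) {c : ℝ} (hc : 0 ≤ c)
    {A : Matrix (Fin n) (Fin n) ℂ} (hA : (matRe A).PosDef)
    {U : Matrix (Fin n) (Fin k) ℂ} (hU : Uᴴ * U = 1) :
    ‖(1 + (c : ℂ) • (Uᴴ * matRe A * U)).det‖ ≤ ∏ i : Fin k, sval (1 + c • A) (Fin.castLE hkn i) := by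
  have hc' : (0 : ℂ) ≤ (c : ℂ) := by exact_mod_cast hc
  have hP : ((c : ℂ) • (Uᴴ * matRe A * U)).PosSemidef := (pd_compress hA hU).posSemidef.smul hc'
  have hK : ((c : ℂ) • (Uᴴ * matIm A * U)).IsHermitian := by
    unfold IsHermitian
    rw [conjTranspose_smul, (herm_compress (matIm_herm A) U).eq]; simp
  refine (det_re_le (PosDef.one.add_posSemidef hP) hK).trans ?_
  refine le_trans (le_of_eq ?_) (det_compress_le hk1 hkn (1 + c • A) hU)
  congr 2
  have e : c • A = (c : ℂ) • A := by
    ext i j; simp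
  rw [e]
  conv_rhs => rw [← re_add_im A]
  simp only [Matrix.mul_add, Matrix.add_mul, Matrix.mul_one, Matrix.mul_smul, Matrix.smul_mul,
    smul_add, hU]
  rw [smul_comm Complex.I (c : ℂ), add_assoc]

lemma det_re_sum_le {k : ℕ} (hk1 : 1 ≤ k) (hkn : k ≤ n) {c : ℝ} (hc : 0 ≤ c)
    {A B : Matrix (Fin n) (Fin n) ℂ} (hA : (matRe A).PosDef) (hB : (matRe B).PosDef)
    {U : Matrix (Fin n) (Fin k) ℂ} (hU : Uᴴ * U = 1) :
    c ^ k * ‖(Uᴴ * matRe (A + B) * U).det‖ ≤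
      (∏ i : Fin k, sval (1 + c • A) (Fin.castLE hkn i)) *
        ∏ i : Fin k, sval (1 + c • B) (Fin.castLE hkn i) := by
  have hc' : (0 : ℂ) ≤ (c : ℂ) := by exact_mod_cast hc
  have hP : ((c : ℂ) • (Uᴴ * matRe A * U)).PosSemidef := (pd_compress hA hU).posSemidef.smul hc'
  have hQ : ((c : ℂ) • (Uᴴ * matRe B * U)).PosSemidef := (pd_compress hB hU).posSemidef.smul hc'
  have e : c ^ k * ‖(Uᴴ * matRe (A + B) * U).det‖ =
      ‖((c : ℂ) • (Uᴴ * matRe A * U) + (c : ℂ) • (Uᴴ * matRe B * U)).det‖ := by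
    rw [← smul_add, ← Matrix.add_mul, ← Matrix.mul_add, ← matRe_add, det_smul, norm_mul, norm_pow,
      Complex.norm_real, Real.norm_of_nonneg hc, Fintype.card_fin]
  rw [e]
  refine (det_add_le hP hQ).trans ?_
  exact mul_le_mul (det_one_add_re_le hk1 hkn hc hA hU) (det_one_add_re_le hk1 hkn hc hB hU)
    (norm_nonneg _) (Finset.prod_nonneg fun i _ => sval_nonneg _ _)

end Sector

/-- For sector matrices `A, B` of angle `α ∈ [0, π/2)` and `1 ≤ k ≤ n`,
`∏_{j=1}^k s_j(A+B) ≤ ∏_{j=1}^k s_j(I + sec²(α)A) ∏_{j=1}^k s_j(I + sec²(α)B)`. -/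
theorem stmt4 {n : ℕ} {α : ℝ} (hα : α ∈ Set.Ico 0 (Real.pi / 2))
    {A B : Matrix (Fin n) (Fin n) ℂ} (hA : InSector α A) (hB : InSector α B)
    {k : ℕ} (hk1 : 1 ≤ k) (hkn : k ≤ n) :
    ∏ j ∈ Finset.univ.filter (fun j : Fin n => (j : ℕ) < k), sval (A + B) j ≤
      (∏ j ∈ Finset.univ.filter (fun j : Fin n => (j : ℕ) < k),
          sval (1 + (Real.cos α)⁻¹ ^ 2 • A) j) *
        ∏ j ∈ Finset.univ.filter (fun j : Fin n => (j : ℕ) < k),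
          sval (1 + (Real.cos α)⁻¹ ^ 2 • B) j := by
  obtain ⟨hα0, hα1⟩ := hα
  have hcos : 0 < Real.cos α := Real.cos_pos_of_mem_Ioo ⟨by linarith [Real.pi_pos], hα1⟩
  set c : ℝ := (Real.cos α)⁻¹ ^ 2 with hc
  set t : ℝ := Real.tan α with ht
  have hct : 1 + t ^ 2 = c := by
    have := Real.sin_sq_add_cos_sq α
    rw [ht, hc, Real.tan_eq_sin_div_cos]
    field_simp
    linarith
  have hc1 : 1 ≤ c := by rw [← hct]; nlinarith [sq_nonneg t]
  have hc0 : 0 ≤ c := by linarith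
  rw [prod_filter_lt hkn, prod_filter_lt hkn, prod_filter_lt hkn]
  set Q := (∏ i : Fin k, sval (1 + c • A) (Fin.castLE hkn i)) *
        ∏ i : Fin k, sval (1 + c • B) (Fin.castLE hkn i) with hQ
  have hQ0 : 0 ≤ Q := mul_nonneg (Finset.prod_nonneg fun i _ => sval_nonneg _ _)
    (Finset.prod_nonneg fun i _ => sval_nonneg _ _)
  by_cases h0 : ∏ i : Fin k, sval (A + B) (Fin.castLE hkn i) = 0
  · rw [h0]; exact hQ0
  obtain ⟨U, V, hU, hV, hdet⟩ := exists_frames hkn (A + B) h0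
  have hRA := sector_re hA
  have hRB := sector_re hB
  have hR : (matRe (A + B)).PosDef := by rw [matRe_add]; exact hRA.add hRB
  have hp : ((t : ℂ) • matRe (A + B) + matIm (A + B)).PosSemidef := by
    have := (sector_bounds hA).1.add (sector_bounds hB).1
    rw [matRe_add, matIm_add, smul_add]
    convert this using 1
    abel
  have hm : ((t : ℂ) • matRe (A + B) - matIm (A + B)).PosSemidef := by
    have := (sector_bounds hA).2.add (sector_bounds hB).2
    rw [matRe_add, matIm_add, smul_add]
    convert this using 1
    abel
  have key := det_sector hR (matIm_herm (A + B)) hp hm U V (pd_compress hR hU)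
  rw [re_add_im, hdet, hct, Fintype.card_fin] at key
  have bU := det_re_sum_le hk1 hkn hc0 hRA hRB hU
  have bV := det_re_sum_le hk1 hkn hc0 hRA hRB hV
  rw [← hQ] at bU bV
  have hck : 1 ≤ c ^ k := one_le_pow₀ hc1
  refine le_of_sq_le_sq (key.trans ?_) hQ0
  have bV' : ‖(Vᴴ * matRe (A + B) * V).det‖ ≤ Q :=
    le_trans (le_mul_of_one_le_left (norm_nonneg _) hck) bV
  rw [pow_two Q]
  exact mul_le_mul bU bV' (norm_nonneg _) hQ0
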